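/- arXiv:1304.4362 — 2 statements merged into one kernel-verified Lean document; each statement's English description precedes it below -/
import Mathlib

section
/- For any real α > 0, ∫_0^1 x^(α-1) log(-log x) dx = -(log α)/α - C/α, where C is the Euler–Mascheroni constant. -/
open Real

lemma integral_log_mul_exp_neg :
    ∫ t in Set.Ioi (0 : ℝ), Real.log t * Real.exp (-t) = -Real.eulerMascheroniConstant := by
  have hd := Complex.hasDerivAt_GammaIntegral (s := 1) (by simp)
  have he : Complex.GammaIntegral =ᶠ[nhds 1] Complex.Gamma := by
    have ho : IsOpen {s : ℂ | 0 < s.re} := isOpen_lt continuous_const Complex.continuous_re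
    filter_upwards [ho.mem_nhds (show (1 : ℂ) ∈ {s : ℂ | 0 < s.re} by simp)] with s hs
    exact (Complex.Gamma_eq_integral hs).symm
  have h := (hd.congr_of_eventuallyEq he.symm).unique Complex.hasDerivAt_Gamma_one
  have hc : ∫ t in Set.Ioi (0 : ℝ), ((Real.log t * Real.exp (-t) : ℝ) : ℂ) =
      ((-Real.eulerMascheroniConstant : ℝ) : ℂ) := by
    simpa using h
  rw [integral_complex_ofReal] at hc
  exact_mod_cast hc

lemma integrableOn_log_mul_exp_neg :
    MeasureTheory.IntegrableOn (fun t => Real.log t * Real.exp (-t)) (Set.Ioi (0 : ℝ)) := by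
  refine MeasureTheory.Integrable.of_integral_ne_zero ?_
  rw [integral_log_mul_exp_neg]
  linarith [Real.one_half_lt_eulerMascheroniConstant]

lemma image_exp_neg_div_Ioi {α : ℝ} (hα : 0 < α) :
    (fun t => Real.exp (-t / α)) '' Set.Ioi 0 = Set.Ioo 0 1 := by
  ext x
  constructor
  · rintro ⟨t, ht, rfl⟩
    exact ⟨Real.exp_pos _, Real.exp_lt_one_iff.2 (div_neg_of_neg_of_pos (neg_neg_of_pos ht) hα)⟩
  · rintro ⟨hx₀, hx₁⟩
    refine ⟨-(α * Real.log x), ?_, ?_⟩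
    · exact neg_pos.2 (mul_neg_of_pos_of_neg hα (Real.log_neg hx₀ hx₁))
    · simp [hα.ne', Real.exp_log hx₀]

theorem integral_rpow_log_neg_log (α : ℝ) (hα : 0 < α) :
    ∫ x in Set.Ioo (0 : ℝ) 1, x ^ (α - 1) * Real.log (-Real.log x) =
      -Real.log α / α - Real.eulerMascheroniConstant / α := by
  have hderiv (t : ℝ) : HasDerivAt (fun t => Real.exp (-t / α)) (Real.exp (-t / α) * (-1 / α)) t :=
    ((hasDerivAt_id t).neg.div_const α).exp
  have hinj : Function.Injective (fun t => Real.exp (-t / α)) := fun s t hst => by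
    simpa [hα.ne', div_left_inj'] using hst
  rw [← image_exp_neg_div_Ioi hα, MeasureTheory.integral_image_eq_integral_abs_deriv_smul
    measurableSet_Ioi (fun t _ => (hderiv t).hasDerivWithinAt) hinj.injOn]
  have hcongr : Set.EqOn
      (fun t => |Real.exp (-t / α) * (-1 / α)| •
        (Real.exp (-t / α) ^ (α - 1) * Real.log (-Real.log (Real.exp (-t / α)))))
      (fun t => α⁻¹ * (Real.log t * Real.exp (-t) - Real.log α * Real.exp (-t)))
      (Set.Ioi 0) := by
    intro t ht
    have habs : |Real.exp (-t / α) * (-1 / α)| = Real.exp (-t / α) * α⁻¹ := by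
      rw [abs_mul, abs_of_pos (Real.exp_pos _), neg_div α 1, abs_neg, one_div,
        abs_of_pos (inv_pos.2 hα)]
    have hexp : Real.exp (-t / α) * Real.exp (-t / α) ^ (α - 1) = Real.exp (-t) := by
      rw [← Real.exp_mul, ← Real.exp_add]
      congr 1
      field_simp
      ring
    have hlog : Real.log (-Real.log (Real.exp (-t / α))) = Real.log t - Real.log α := by
      rw [Real.log_exp, neg_div, neg_neg, Real.log_div (ne_of_gt ht) hα.ne']
    simp only [smul_eq_mul, habs, hlog]
    rw [← hexp]
    ring
  rw [MeasureTheory.setIntegral_congr_fun measurableSet_Ioi hcongr,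
    MeasureTheory.integral_const_mul,
    MeasureTheory.integral_sub integrableOn_log_mul_exp_neg
      ((integrableOn_exp_neg_Ioi 0).const_mul _),
    MeasureTheory.integral_const_mul, integral_log_mul_exp_neg, integral_exp_neg_Ioi_zero]
  field_simp
  ring
end

section
/- For fixed I ≥ 1, defining b_N(I) = -[C(N,I) ∑_{m=0}^I C(I,m)(-1)^m log(N-I+m)]^{-1} and f(x) = -(1-x)log(1-x) with x = I/N, one has f(x)/(b_N(I)/N) = 1 - I/(12N²) + O(1/N³) as N → ∞. -/
open Filter Asymptotics

noncomputable def bCoeff (N I : ℕ) : ℝ :=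
  -((N.choose I : ℝ) *
      ∑ m ∈ Finset.range (I + 1), (I.choose m : ℝ) * (-1 : ℝ) ^ m *
        Real.log ((N : ℝ) - I + m))⁻¹

/-- `f N` agrees with `1 + a / N + b / N ^ 2` up to `O(1 / N ^ 3)`. -/
def HasQuadExpansion (f : ℕ → ℝ) (a b : ℝ) : Prop :=
  (fun N : ℕ => f N - (1 + a / N + b / (N : ℝ) ^ 2)) =O[atTop] (fun N : ℕ => 1 / (N : ℝ) ^ 3)

theorem isBigO_inv_pow_of_le {m n : ℕ} (h : m ≤ n) :
    (fun N : ℕ => 1 / (N : ℝ) ^ n) =O[atTop] (fun N : ℕ => 1 / (N : ℝ) ^ m) := by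
  refine IsBigO.of_bound 1 ?_
  filter_upwards [eventually_ge_atTop 1] with N hN
  have hN' : (1 : ℝ) ≤ N := by exact_mod_cast hN
  rw [one_mul, Real.norm_of_nonneg (by positivity), Real.norm_of_nonneg (by positivity)]
  exact one_div_le_one_div_of_le (by positivity) (pow_le_pow_right₀ hN' h)

theorem isBigO_one_of_quad (a b : ℝ) :
    (fun N : ℕ => 1 + a / N + b / (N : ℝ) ^ 2) =O[atTop] (fun _ : ℕ => (1 : ℝ)) := by
  have h (n : ℕ) (c : ℝ) :
      (fun N : ℕ => c * (1 / (N : ℝ) ^ n)) =O[atTop] (fun _ : ℕ => (1 : ℝ)) := by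
    simpa using (isBigO_inv_pow_of_le (Nat.zero_le n)).const_mul_left c
  refine (((h 0 1).add (h 1 a)).add (h 2 b)).congr_left fun N => ?_
  simp [div_eq_mul_inv]

theorem HasQuadExpansion.mul {f g : ℕ → ℝ} {a b c d : ℝ} (hf : HasQuadExpansion f a b)
    (hg : HasQuadExpansion g c d) :
    HasQuadExpansion (fun N => f N * g N) (a + c) (b + a * c + d) := by
  have hg1 : g =O[atTop] (fun _ : ℕ => (1 : ℝ)) := by
    have h0 : (fun N : ℕ => 1 / (N : ℝ) ^ 3) =O[atTop] (fun _ : ℕ => (1 : ℝ)) := by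
      simpa using isBigO_inv_pow_of_le (Nat.zero_le 3)
    refine ((hg.trans h0).add (isBigO_one_of_quad c d)).congr_left fun N => by ring
  have h1 := IsBigO.mul hf hg1
  have h2 := (isBigO_one_of_quad a b).mul hg
  have h3 := (isBigO_refl (fun N : ℕ => 1 / (N : ℝ) ^ 3) atTop).const_mul_left (a * d + b * c)
  have h4 := (isBigO_inv_pow_of_le (show 3 ≤ 4 by norm_num)).const_mul_left (b * d)
  simp only [mul_one] at h1
  simp only [one_mul] at h2
  refine (((h1.add h2).add h3).add h4).congr_left fun N => ?_
  simp only [div_eq_mul_inv, one_mul, ← inv_pow]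
  ring

theorem HasQuadExpansion.congr' {f g : ℕ → ℝ} {a b c d : ℝ} (hf : HasQuadExpansion f a b)
    (hfg : f =ᶠ[atTop] g) (hac : a = c) (hbd : b = d) : HasQuadExpansion g c d := by
  subst hac hbd
  refine IsBigO.congr' hf ?_ EventuallyEq.rfl
  filter_upwards [hfg] with N hN
  rw [hN]

theorem hasQuadExpansion_quad (a b : ℝ) :
    HasQuadExpansion (fun N : ℕ => 1 + a / N + b / (N : ℝ) ^ 2) a b := by
  simpa [HasQuadExpansion] using isBigO_zero _ _

theorem hasQuadExpansion_prod (I : ℕ) :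
    HasQuadExpansion (fun N : ℕ => ∏ j ∈ Finset.range I, (1 - (j : ℝ) / N))
      (-(I * (I - 1) / 2)) (I * (I - 1) * (I - 2) * (3 * I - 1) / 24) := by
  induction I with
  | zero =>
    refine (hasQuadExpansion_quad 0 0).congr' (.of_forall fun N => ?_) ?_ ?_ <;> simp
  | succ n ih =>
    refine (ih.mul (hasQuadExpansion_quad (-n) 0)).congr' (.of_forall fun N => ?_) ?_ ?_
    · simp only [Finset.prod_range_succ]
      ring
    · push_cast
      ring
    · push_cast
      ring

theorem choose_mul_factorial_div_pow (I : ℕ) {N : ℕ} (hN : N ≠ 0) :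
    (N.choose I : ℝ) * I.factorial / (N : ℝ) ^ I = ∏ j ∈ Finset.range I, (1 - (j : ℝ) / N) := by
  have hN' : (N : ℝ) ≠ 0 := by exact_mod_cast hN
  have h : (N.choose I : ℝ) * I.factorial = ∏ j ∈ Finset.range I, ((N : ℝ) - j) := by
    rw [← descPochhammer_eval_eq_prod_range, descPochhammer_eval_eq_descFactorial,
      Nat.descFactorial_eq_factorial_mul_choose]
    push_cast
    ring
  rw [h, ← Finset.card_range I, ← Finset.prod_const, Finset.card_range, ← Finset.prod_div_distrib]
  exact Finset.prod_congr rfl fun j _ => by field_simp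

/-- The alternating sum counting surjections from a `k`-element set onto an `I`-element set. -/
noncomputable def surjSum (I k : ℕ) : ℝ :=
  ∑ m ∈ Finset.range (I + 1), (I.choose m : ℝ) * (-1 : ℝ) ^ m * ((I : ℝ) - m) ^ k

theorem surjSum_zero_right (n : ℕ) : surjSum (n + 1) 0 = 0 := by
  have h := add_pow (-1 : ℝ) 1 (n + 1)
  simp only [neg_add_cancel, one_pow, mul_one, ne_eq, Nat.add_eq_zero_iff, one_ne_zero, and_false,
    not_false_eq_true, zero_pow] at h
  rw [surjSum, h]
  exact Finset.sum_congr rfl fun m _ => by ring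

theorem surjSum_succ_succ (n k : ℕ) :
    surjSum (n + 1) (k + 1) = (n + 1) * (surjSum n k + surjSum (n + 1) k) := by
  have h1 : surjSum (n + 1) (k + 1) =
      (n + 1) * ∑ m ∈ Finset.range (n + 1),
        (n.choose m : ℝ) * (-1 : ℝ) ^ m * ((n : ℝ) + 1 - m) ^ k := by
    rw [surjSum, Finset.sum_range_succ, Finset.mul_sum]
    simp only [Nat.cast_add, Nat.cast_one, sub_self, ne_eq, Nat.add_eq_zero_iff, one_ne_zero,
      and_false, not_false_eq_true, zero_pow, mul_zero, add_zero]
    refine Finset.sum_congr rfl fun m hm => ?_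
    have hm' : m ≤ n := Nat.lt_succ_iff.mp (Finset.mem_range.mp hm)
    have h : ((n + 1).choose m : ℝ) * ((n : ℝ) + 1 - m) = (n + 1) * (n.choose m : ℝ) := by
      have := Nat.choose_mul_succ_eq n m
      have h' : ((n.choose m * (n + 1) : ℕ) : ℝ) = (((n + 1).choose m * (n + 1 - m) : ℕ) : ℝ) := by
        exact_mod_cast this
      rw [Nat.cast_mul, Nat.cast_mul, Nat.cast_sub (by omega)] at h'
      push_cast at h'
      linarith
    rw [pow_succ]
    linear_combination ((-1 : ℝ) ^ m * ((n : ℝ) + 1 - m) ^ k) * h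
  have h2 : surjSum (n + 1) k = (∑ m ∈ Finset.range (n + 1),
        (n.choose m : ℝ) * (-1 : ℝ) ^ m * ((n : ℝ) + 1 - m) ^ k) - surjSum n k := by
    rw [surjSum, Finset.sum_range_succ', surjSum]
    have h3 : ∑ m ∈ Finset.range (n + 1),
        (n.choose m : ℝ) * (-1 : ℝ) ^ m * ((n : ℝ) + 1 - m) ^ k =
        ∑ m ∈ Finset.range (n + 1 + 1),
        (n.choose m : ℝ) * (-1 : ℝ) ^ m * ((n : ℝ) + 1 - m) ^ k := by
      rw [Finset.sum_range_succ _ (n + 1)]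
      simp
    rw [h3, Finset.sum_range_succ' _ (n + 1), add_sub_right_comm, ← Finset.sum_sub_distrib]
    congr 1
    · refine Finset.sum_congr rfl fun m _ => ?_
      rw [Nat.choose_succ_succ]
      push_cast
      ring
    · simp
  rw [h1, h2]
  ring

theorem surjSum_zero_left_succ (k : ℕ) : surjSum 0 (k + 1) = 0 := by
  simp [surjSum]

theorem surjSum_of_lt {n k : ℕ} (h : k < n) : surjSum n k = 0 := by
  induction k generalizing n with
  | zero =>
    obtain ⟨n, rfl⟩ := Nat.exists_eq_succ_of_ne_zero h.ne'
    exact surjSum_zero_right n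
  | succ k ih =>
    obtain ⟨n, rfl⟩ := Nat.exists_eq_succ_of_ne_zero (Nat.ne_zero_of_lt h)
    rw [Nat.succ_eq_add_one, surjSum_succ_succ, ih (by omega), ih (by omega)]
    simp

theorem surjSum_self (n : ℕ) : surjSum n n = n.factorial := by
  induction n with
  | zero => simp [surjSum]
  | succ n ih =>
    rw [surjSum_succ_succ, ih, surjSum_of_lt n.lt_succ_self, Nat.factorial_succ]
    push_cast
    ring

theorem surjSum_add_one (n : ℕ) : surjSum n (n + 1) = n.factorial * (n * (n + 1) / 2) := by
  induction n with
  | zero => simp [surjSum]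
  | succ n ih =>
    rw [surjSum_succ_succ, ih, surjSum_self, Nat.factorial_succ]
    push_cast
    ring

theorem surjSum_add_two (n : ℕ) :
    surjSum n (n + 2) = n.factorial * (n * (n + 1) * (n + 2) * (3 * n + 1) / 24) := by
  induction n with
  | zero => simp [surjSum]
  | succ n ih =>
    rw [surjSum_succ_succ, ih, surjSum_add_one, Nat.factorial_succ]
    push_cast
    ring

theorem isBigO_log_one_sub_taylor (c : ℝ) (n : ℕ) :
    (fun N : ℕ => (∑ i ∈ Finset.range n, (c / N) ^ (i + 1) / (i + 1)) + Real.log (1 - c / N))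
      =O[atTop] (fun N : ℕ => 1 / (N : ℝ) ^ (n + 1)) := by
  refine IsBigO.of_bound (2 * |c| ^ (n + 1)) ?_
  have ht : Tendsto (fun N : ℕ => |c / N|) atTop (nhds 0) := by
    simpa using (tendsto_const_div_atTop_nhds_zero_nat c).abs
  filter_upwards [ht.eventually_lt_const (show (0 : ℝ) < 1 / 2 by norm_num)] with N hN
  refine (Real.abs_log_sub_add_sum_range_le (by linarith) n).trans ?_
  have h : |c / (N : ℝ)| ^ (n + 1) = |c| ^ (n + 1) * (1 / (N : ℝ) ^ (n + 1)) := by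
    rw [abs_div, Nat.abs_cast, div_pow]
    ring
  rw [Real.norm_of_nonneg (by positivity), mul_assoc, ← h, div_le_iff₀ (by linarith)]
  nlinarith [pow_nonneg (abs_nonneg (c / (N : ℝ))) (n + 1)]

theorem hasQuadExpansion_mul_log {I : ℕ} (hI : I ≠ 0) :
    HasQuadExpansion
      (fun N : ℕ => -(N / I : ℝ) * Real.log (1 - (I : ℝ) / N)) (I / 2) (I ^ 2 / 3) := by
  have hI' : (I : ℝ) ≠ 0 := by exact_mod_cast hI
  have h := ((isBigO_refl (fun N : ℕ => (N : ℝ)) atTop).mul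
    (isBigO_log_one_sub_taylor (I : ℝ) 3)).const_mul_left (-(1 / I : ℝ))
  refine IsBigO.congr' h ?_ ?_
  · filter_upwards [eventually_ne_atTop 0] with N hN
    have hN' : (N : ℝ) ≠ 0 := by exact_mod_cast hN
    simp only [Finset.sum_range_succ, Finset.sum_range_zero]
    generalize Real.log (1 - (I : ℝ) / N) = L
    push_cast
    field_simp
    ring
  · filter_upwards [eventually_ne_atTop 0] with N hN
    have hN' : (N : ℝ) ≠ 0 := by exact_mod_cast hN
    field_simp

theorem sum_choose_log_eq {n N : ℕ} (h : n + 1 < N) :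
    ∑ m ∈ Finset.range (n + 1 + 1), ((n + 1).choose m : ℝ) * (-1 : ℝ) ^ m *
        Real.log ((N : ℝ) - (n + 1 : ℕ) + m) =
      ∑ m ∈ Finset.range (n + 1 + 1), ((n + 1).choose m : ℝ) * (-1 : ℝ) ^ m *
        Real.log (1 - (((n + 1 : ℕ) : ℝ) - m) / N) := by
  have hN : (0 : ℝ) < N := by exact_mod_cast (by omega : 0 < N)
  have h' : ((n + 1 : ℕ) : ℝ) < N := by exact_mod_cast h
  have h0 : ∑ m ∈ Finset.range (n + 1 + 1), ((n + 1).choose m : ℝ) * (-1 : ℝ) ^ m *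
      Real.log N = 0 := by
    rw [← Finset.sum_mul]
    have := surjSum_zero_right n
    simp only [surjSum, pow_zero, mul_one] at this
    rw [this, zero_mul]
  rw [← sub_eq_zero, ← Finset.sum_sub_distrib, ← h0]
  refine Finset.sum_congr rfl fun m _ => ?_
  have hm : (0 : ℝ) ≤ m := m.cast_nonneg
  have hpos : 0 < (N : ℝ) - (n + 1 : ℕ) + m := by linarith
  have he : 1 - (((n + 1 : ℕ) : ℝ) - m) / N = ((N : ℝ) - (n + 1 : ℕ) + m) / N := by
    field_simp
    ring
  rw [he, Real.log_div hpos.ne' hN.ne']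
  ring

theorem hasQuadExpansion_sum_choose_log (n : ℕ) :
    HasQuadExpansion
      (fun N : ℕ => -((N : ℝ) ^ (n + 1) / n.factorial) *
        ∑ m ∈ Finset.range (n + 1 + 1), ((n + 1).choose m : ℝ) * (-1 : ℝ) ^ m *
          Real.log ((N : ℝ) - (n + 1 : ℕ) + m))
      ((n + 1) ^ 2 / 2) ((n + 1) ^ 2 * (n + 2) * (3 * n + 4) / 24) := by
  have hsum : (fun N : ℕ => ∑ m ∈ Finset.range (n + 1 + 1),
      ((n + 1).choose m : ℝ) * (-1 : ℝ) ^ m *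
      ((∑ i ∈ Finset.range (n + 3), ((((n + 1 : ℕ) : ℝ) - m) / N) ^ (i + 1) / (i + 1)) +
        Real.log (1 - (((n + 1 : ℕ) : ℝ) - m) / N)))
      =O[atTop] (fun N : ℕ => 1 / (N : ℝ) ^ (n + 3 + 1)) :=
    IsBigO.fun_sum fun m _ => (isBigO_log_one_sub_taylor _ (n + 3)).const_mul_left _
  have h := ((isBigO_refl (fun N : ℕ => (N : ℝ) ^ (n + 1)) atTop).mul hsum).const_mul_left
    (-(1 / n.factorial : ℝ))
  refine IsBigO.congr' h ?_ ?_
  · filter_upwards [eventually_gt_atTop (n + 1)] with N hN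
    have hN' : (N : ℝ) ≠ 0 := by exact_mod_cast (by omega : N ≠ 0)
    have hf : (n.factorial : ℝ) ≠ 0 := by exact_mod_cast n.factorial_ne_zero
    have hpoly : ∑ m ∈ Finset.range (n + 1 + 1), ((n + 1).choose m : ℝ) * (-1 : ℝ) ^ m *
        (∑ i ∈ Finset.range (n + 3), ((((n + 1 : ℕ) : ℝ) - m) / N) ^ (i + 1) / (i + 1)) =
        ∑ i ∈ Finset.range (n + 3), surjSum (n + 1) (i + 1) / ((i + 1) * (N : ℝ) ^ (i + 1)) := by
      simp only [Finset.mul_sum, surjSum, Finset.sum_div]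
      rw [Finset.sum_comm]
      refine Finset.sum_congr rfl fun i _ => Finset.sum_congr rfl fun m _ => ?_
      rw [div_pow]
      field_simp
    have hlow : ∑ i ∈ Finset.range n,
        surjSum (n + 1) (i + 1) / ((i + 1) * (N : ℝ) ^ (i + 1)) = 0 :=
      Finset.sum_eq_zero fun i hi => by
        rw [surjSum_of_lt (by simpa using hi), zero_div]
    simp only [mul_add, Finset.sum_add_distrib]
    rw [hpoly, sum_choose_log_eq hN, Finset.sum_range_succ, Finset.sum_range_succ,
      Finset.sum_range_succ, hlow, surjSum_self, surjSum_add_one (n + 1), surjSum_add_two (n + 1),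
      Nat.factorial_succ]
    push_cast
    generalize (∑ m ∈ Finset.range (n + 1 + 1), ((n + 1).choose m : ℝ) * (-1 : ℝ) ^ m *
        Real.log (1 - ((n : ℝ) + 1 - m) / N)) = L
    have h1 : (n : ℝ) + 1 ≠ 0 := by positivity
    have h2 : (n : ℝ) + 1 + 1 ≠ 0 := by positivity
    have h3 : (n : ℝ) + 2 + 1 ≠ 0 := by positivity
    field_simp
    ring
  · filter_upwards [eventually_ne_atTop 0] with N hN
    have hN' : (N : ℝ) ≠ 0 := by exact_mod_cast hN
    field_simp
    ring

theorem ratio_expansion (I : ℕ) (hI : 1 ≤ I) :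
    (fun N : ℕ =>
        (-(1 - (I : ℝ) / N) * Real.log (1 - (I : ℝ) / N)) / (bCoeff N I / N) -
          (1 - (I : ℝ) / (12 * (N : ℝ) ^ 2)))
      =O[atTop] (fun N : ℕ => 1 / (N : ℝ) ^ 3) := by
  obtain ⟨n, rfl⟩ := Nat.exists_eq_add_of_le' hI
  have h := (((hasQuadExpansion_quad (-((n + 1 : ℕ) : ℝ)) 0).mul
    (hasQuadExpansion_mul_log n.succ_ne_zero)).mul (hasQuadExpansion_prod (n + 1))).mul
    (hasQuadExpansion_sum_choose_log n)
  refine IsBigO.congr' h ?_ EventuallyEq.rfl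
  filter_upwards [eventually_ne_atTop 0] with N hN
  have hN' : (N : ℝ) ≠ 0 := by exact_mod_cast hN
  have hf : (n.factorial : ℝ) ≠ 0 := by exact_mod_cast n.factorial_ne_zero
  have h1 : (n : ℝ) + 1 ≠ 0 := by positivity
  rw [← choose_mul_factorial_div_pow (n + 1) hN, bCoeff, Nat.factorial_succ]
  generalize (∑ m ∈ Finset.range (n + 1 + 1), ((n + 1).choose m : ℝ) * (-1 : ℝ) ^ m *
    Real.log ((N : ℝ) - (n + 1 : ℕ) + m)) = S
  generalize Real.log (1 - ((n + 1 : ℕ) : ℝ) / N) = L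
  simp only [div_div_eq_mul_div, div_neg, div_inv_eq_mul]
  push_cast
  field_simp
  ring
end
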